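/- Let G be a finite simple graph with at most 5 vertices. Then G cannot simultaneously contain a pair of distinct vertices u ≠ u' with N(u) = N(u') (proper false twin vertices) and a pair of distinct two-element vertex sets {a,b} ≠ {a',b'}, each inducing an edge of G, which are F-twins of each other (proper F-twin edges). -/

import Mathlib

/-- `V1` and `V2` (as vertex sets of induced subgraphs of `G`) are F-twins via the
bijection `φ : V1 → V2`: `φ` is an isomorphism of the induced subgraphs and every
`u ∈ V1` satisfies `N(u) \ V1 = N(φ u) \ V2`. -/
def SimpleGraph.IsFTwinVia {V : Type*} (G : SimpleGraph V) (V1 V2 : Set V) (φ : V → V) : Prop :=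
  Set.BijOn φ V1 V2 ∧
  (∀ u ∈ V1, ∀ v ∈ V1, (G.Adj u v ↔ G.Adj (φ u) (φ v))) ∧
  (∀ u ∈ V1, G.neighborSet u \ V1 = G.neighborSet (φ u) \ V2)

/-- `V1` and `V2` are F-twins. -/
def SimpleGraph.FTwins {V : Type*} (G : SimpleGraph V) (V1 V2 : Set V) : Prop :=
  ∃ φ : V → V, G.IsFTwinVia V1 V2 φ

/-- Proper F-twin edges `ab` and `cd`, matched by `a ↦ c` and `b ↦ d`, are disjoint and have no
edges between them. -/
theorem SimpleGraph.IsFTwinVia.disjoint_edges {V : Type*} {G : SimpleGraph V} {a b : V}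
    {W : Set V} {φ : V → V} (hφ : G.IsFTwinVia {a, b} W φ) (hab : G.Adj a b)
    (hne : ({a, b} : Set V) ≠ W) :
    G.Adj (φ a) (φ b) ∧ [a, b, φ a, φ b].Nodup ∧
      (¬ G.Adj a (φ a) ∧ ¬ G.Adj a (φ b) ∧ ¬ G.Adj b (φ a) ∧ ¬ G.Adj b (φ b)) ∧
      (∀ x, x ∉ [a, b, φ a, φ b] →
        (G.Adj a x ↔ G.Adj (φ a) x) ∧ (G.Adj b x ↔ G.Adj (φ b) x)) := by
  obtain ⟨hbij, hadj, hnbr⟩ := hφ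
  have hW : W = {φ a, φ b} := by rw [← hbij.image_eq, Set.image_pair]
  subst hW
  have hcd : G.Adj (φ a) (φ b) := (hadj a (by simp) b (by simp)).1 hab
  have ha : ∀ x, (G.Adj a x ∧ ¬ (x = a ∨ x = b)) ↔
      (G.Adj (φ a) x ∧ ¬ (x = φ a ∨ x = φ b)) := fun x ↦ Set.ext_iff.1 (hnbr a (by simp)) x
  have hb : ∀ x, (G.Adj b x ∧ ¬ (x = a ∨ x = b)) ↔
      (G.Adj (φ b) x ∧ ¬ (x = φ a ∨ x = φ b)) := fun x ↦ Set.ext_iff.1 (hnbr b (by simp)) x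
  have hne₁ := hab.ne
  have hne₂ := hcd.ne
  generalize φ a = c at *
  generalize φ b = d at *
  have hba := hab.symm
  have hdc := hcd.symm
  have hac : a ≠ c := by
    rintro rfl
    have := ha b
    have := ha d
    grind
  have had : a ≠ d := by
    rintro rfl
    have := ha b
    have := ha c
    have := hb b
    have := hb c
    have := Set.pair_comm a b
    grind
  have hbc : b ≠ c := by
    rintro rfl
    have := ha a
    have := ha d
    have := hb a
    have := hb d
    have := Set.pair_comm a b
    grind
  have hbd : b ≠ d := by
    rintro rfl
    have := hb a
    have := hb c
    grind
  refine ⟨hcd, by simp_all, ?_, ?_⟩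
  · have := ha c
    have := ha d
    have := hb c
    have := hb d
    grind
  · intro x hx
    have := ha x
    have := hb x
    simp only [List.mem_cons, List.not_mem_nil, or_false, not_or] at hx
    tauto

/-- A graph with at most `5` vertices cannot simultaneously display a pair of proper false
twin vertices and a pair of proper F-twin edges. -/
theorem no_false_twin_and_ftwin_edge_of_card_le_five {V : Type*} [Fintype V]
    (G : SimpleGraph V) (hcard : Fintype.card V ≤ 5) :
    ¬ ((∃ u u' : V, u ≠ u' ∧ G.neighborSet u = G.neighborSet u') ∧
       (∃ a b a' b' : V, G.Adj a b ∧ G.Adj a' b' ∧ ({a, b} : Set V) ≠ {a', b'} ∧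
         G.FTwins {a, b} {a', b'})) := by
  rintro ⟨⟨u, u', hu, huu'⟩, a, b, a', b', hab, -, hne, φ, hφ⟩
  obtain ⟨hcd, hnodup, hcross, hout⟩ := hφ.disjoint_edges hab hne
  have htwin : ∀ x, G.Adj u x ↔ G.Adj u' x := fun x ↦ Set.ext_iff.1 huu' x
  generalize φ a = c at *
  generalize φ b = d at *
  have hunique : u ∈ [a, b, c, d] ∨ u' ∈ [a, b, c, d] := by
    by_contra! h
    have hlen : [u, u', a, b, c, d].Nodup := by
      simp only [List.nodup_cons] at hnodup ⊢
      grind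
    have := hlen.length_le_card
    simp only [List.length_cons, List.length_nil] at this
    omega
  have h₁ := htwin a
  have h₂ := htwin b
  have h₃ := htwin c
  have h₄ := htwin d
  have hou := hout u
  have hou' := hout u'
  have hsymm : ∀ x y, G.Adj x y ↔ G.Adj y x := G.adj_comm
  have hirr : ∀ x, ¬ G.Adj x x := fun x ↦ G.irrefl
  clear hout htwin huu' hφ hne
  simp only [List.mem_cons, List.not_mem_nil, or_false] at hunique hou hou'
  grind
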